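/- arXiv:2605.29469 — 2 statements merged into one kernel-verified Lean document; each statement's English description precedes it below -/
import Mathlib

section
/- Let β ∈ (0,1), μ > 0, α ≥ 0, and let G : ℝ → ℂ be a square-integrable function such that ∫_ℝ |λ|^{2αη} |G(λ)|² dλ < ∞ for some η ∈ (0,1]. Then there exists C > 0 such that for all t, s > 0, ∫_ℝ |G(λ)|² · |E_β(−μ t^β |λ|^α) − E_β(−μ s^β |λ|^α)|² dλ ≤ C |t − s|^{2ηβ}. (This expresses, via the Itô isometry, that the limit field U₀^g(t,x) of Theorem 3.1, with G = ĝ(·,x), is mean-square Hölder continuous in time of any order γ_t ∈ (0, η_*β).) -/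
open Real MeasureTheory

/-- The Mittag-Leffler function `E_β(s) = ∑_{k=0}^∞ s^k / Γ(1 + βk)`. -/
noncomputable def mittagLeffler (β s : ℝ) : ℝ :=
  ∑' k : ℕ, s ^ k / Real.Gamma (1 + β * k)

/-- A crude super-exponential lower bound for the Gamma function. -/
lemma exp_neg_mul_rpow_le_Gamma {M s : ℝ} (hM : 0 < M) (hs : 0 ≤ s) :
    Real.exp (-M) * M ^ s ≤ Real.Gamma (1 + s) := by
  have hint := Real.GammaIntegral_convergent (s := 1 + s) (by linarith)
  rw [Real.Gamma_eq_integral (by linarith), ← integral_exp_neg_Ioi M, ← integral_mul_const]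
  have hsub : Set.Ioi M ⊆ Set.Ioi 0 := Set.Ioi_subset_Ioi hM.le
  calc ∫ x in Set.Ioi M, Real.exp (-x) * M ^ s
      ≤ ∫ x in Set.Ioi M, Real.exp (-x) * x ^ (1 + s - 1) := by
        refine setIntegral_mono_on ((integrableOn_exp_neg_Ioi M).mul_const _)
          (hint.mono_set hsub) measurableSet_Ioi fun x hx ↦ ?_
        rw [add_sub_cancel_left]
        have := Real.rpow_le_rpow hM.le (le_of_lt hx) hs
        gcongr
    _ ≤ _ := by
        refine setIntegral_mono_set hint ?_ hsub.eventuallyLE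
        refine ae_restrict_of_forall_mem measurableSet_Ioi fun x (hx : 0 < x) ↦ ?_
        show 0 ≤ Real.exp (-x) * x ^ (1 + s - 1)
        positivity

lemma summable_pow_div_Gamma {β : ℝ} (hβ : 0 < β) {R : ℝ} (hR : 0 ≤ R) :
    Summable fun k : ℕ ↦ R ^ k / Real.Gamma (1 + β * k) := by
  set M : ℝ := (2 * R + 1) ^ (1 / β) with hMdef
  have hM : 0 < M := by positivity
  have hMβ : M ^ β = 2 * R + 1 := by
    rw [hMdef, ← Real.rpow_mul (by positivity), one_div_mul_cancel hβ.ne', Real.rpow_one]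
  have hgeom : Summable fun k : ℕ ↦ Real.exp M * (1 / 2 : ℝ) ^ k :=
    (summable_geometric_of_lt_one (by norm_num) (by norm_num)).mul_left _
  refine hgeom.of_nonneg_of_le
    (fun k ↦ div_nonneg (by positivity) (Real.Gamma_nonneg_of_nonneg (by positivity))) fun k ↦ ?_
  have hΓ := exp_neg_mul_rpow_le_Gamma hM (s := β * k) (by positivity)
  rw [Real.rpow_mul hM.le, hMβ, Real.rpow_natCast, Real.exp_neg] at hΓ
  rw [div_le_iff₀ (Real.Gamma_pos_of_pos (by positivity))]
  calc R ^ k ≤ (1 / 2 : ℝ) ^ k * (2 * R + 1) ^ k := by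
        rw [← mul_pow]; gcongr; linarith
    _ = Real.exp M * (1 / 2 : ℝ) ^ k * ((Real.exp M)⁻¹ * (2 * R + 1) ^ k) := by
        field_simp
    _ ≤ _ := by gcongr

lemma intervalIntegrable_betaIntegrand {a b : ℝ} (ha : 0 < a) (hb : 0 < b) :
    IntervalIntegrable (fun r : ℝ ↦ r ^ (a - 1) * (1 - r) ^ (b - 1)) volume 0 1 := by
  have h := Complex.betaIntegral_convergent (u := a) (v := b) (by simpa) (by simpa)
  rw [intervalIntegrable_iff_integrableOn_Ioo_of_le zero_le_one] at h ⊢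
  refine (Integrable.re h).congr ?_
  refine ae_restrict_of_forall_mem measurableSet_Ioo fun x hx ↦ ?_
  have h1 : (0 : ℝ) ≤ 1 - x := by linarith [hx.2]
  have : ((x : ℂ) ^ ((a : ℂ) - 1) * (1 - (x : ℂ)) ^ ((b : ℂ) - 1)) =
      ((x ^ (a - 1) * (1 - x) ^ (b - 1) : ℝ) : ℂ) := by
    push_cast [Complex.ofReal_cpow hx.1.le, Complex.ofReal_cpow h1]
    rfl
  simp only [this]
  exact RCLike.ofReal_re (K := ℂ) _

lemma integral_betaIntegrand {a b : ℝ} (ha : 0 < a) (hb : 0 < b) :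
    ∫ r in (0 : ℝ)..1, r ^ (a - 1) * (1 - r) ^ (b - 1) =
      Real.Gamma a * Real.Gamma b / Real.Gamma (a + b) := by
  have h := ProbabilityTheory.beta_eq_betaIntegralReal a b ha hb
  rw [ProbabilityTheory.beta] at h
  rw [h, Complex.betaIntegral, ← Complex.ofReal_re (∫ r in (0 : ℝ)..1, _),
    ← intervalIntegral.integral_ofReal]
  congr 1
  refine intervalIntegral.integral_congr fun x hx ↦ ?_
  rw [Set.uIcc_of_le zero_le_one] at hx
  have h1 : (0 : ℝ) ≤ 1 - x := by linarith [hx.2]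
  push_cast [Complex.ofReal_cpow hx.1, Complex.ofReal_cpow h1]
  rfl

lemma one_sub_rpow_le {r γ : ℝ} (hr : 0 < r) (hr1 : r ≤ 1) (hγ : 0 ≤ γ) :
    1 - r ^ γ ≤ (1 + γ) * (1 - r) := by
  have h := one_add_mul_self_le_rpow_one_add (s := r - 1) (by linarith) (p := 1 + γ) (by linarith)
  have h2 : r ^ (1 + γ) ≤ r ^ γ := Real.rpow_le_rpow_of_exponent_ge hr hr1 (by linarith)
  rw [add_sub_cancel] at h
  linarith

lemma intervalIntegrable_one_sub_rpow_mul {β : ℝ} (hβ : 0 < β) (hβ1 : β < 1) {γ : ℝ} (hγ : 0 ≤ γ) :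
    IntervalIntegrable (fun r : ℝ ↦ (1 - r ^ γ) * (1 - r) ^ (-1 - β)) volume 0 1 := by
  have h := (intervalIntegrable_betaIntegrand one_pos (sub_pos.2 hβ1)).const_mul (1 + γ)
  rw [intervalIntegrable_iff_integrableOn_Ioo_of_le zero_le_one] at h ⊢
  refine h.mono' (by fun_prop) ?_
  refine ae_restrict_of_forall_mem measurableSet_Ioo fun r hr ↦ ?_
  have h1 : 0 < 1 - r := by linarith [hr.2]
  have h0 : 0 ≤ 1 - r ^ γ := sub_nonneg.2 (Real.rpow_le_one hr.1.le hr.2.le hγ)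
  rw [Real.norm_of_nonneg (by positivity)]
  calc _ ≤ (1 + γ) * (1 - r) * (1 - r) ^ (-1 - β) := by
        gcongr; exact one_sub_rpow_le hr.1 hr.2.le hγ
    _ = _ := by
        rw [mul_assoc, ← Real.rpow_one_add' h1.le (by ring_nf; simpa using hβ.ne'),
          sub_self, Real.rpow_zero, one_mul]
        ring_nf

/-- The Marchaud (Caputo) fractional derivative of the monomial `r ^ γ` at `1`. -/
lemma integral_one_sub_rpow_mul {β : ℝ} (hβ : 0 < β) (hβ1 : β < 1) {γ : ℝ} (hγ : 0 ≤ γ) :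
    β * ∫ r in (0 : ℝ)..1, (1 - r ^ γ) * (1 - r) ^ (-1 - β) =
      Real.Gamma (1 - β) * Real.Gamma (1 + γ) / Real.Gamma (1 + γ - β) - 1 := by
  rcases hγ.eq_or_lt with rfl | hγ
  · have := (Real.Gamma_pos_of_pos (sub_pos.2 hβ1)).ne'
    simp [this]
  have hβ1' : 0 < 1 - β := sub_pos.2 hβ1
  have hB := intervalIntegrable_betaIntegrand hγ hβ1'
  have hI := intervalIntegrable_one_sub_rpow_mul hβ hβ1 hγ.le
  set F : ℝ → ℝ := fun r ↦ (1 - r ^ γ) * (1 - r) ^ (-β)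
  have hcont : ContinuousOn F (Set.Icc 0 1) := by
    intro r hr
    rcases hr.2.eq_or_lt with rfl | hr1
    · have hF1 : F 1 = 0 := by simp [F]
      rw [ContinuousWithinAt, hF1]
      refine squeeze_zero_norm' (a := fun r : ℝ ↦ (1 + γ) * (1 - r) ^ (1 - β)) ?_ ?_
      · filter_upwards [self_mem_nhdsWithin, mem_nhdsWithin_of_mem_nhds (lt_mem_nhds one_pos)]
          with r hr hr0
        have h0 : 0 ≤ 1 - r ^ γ := sub_nonneg.2 (Real.rpow_le_one hr.1 hr.2 hγ.le)
        have h1 : 0 ≤ 1 - r := by linarith [hr.2]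
        simp only [F]
        rw [Real.norm_of_nonneg (by positivity), Real.rpow_one_sub' h1 hβ1'.ne', ← mul_div_assoc,
          Real.rpow_neg h1, ← div_eq_mul_inv]
        gcongr
        exact one_sub_rpow_le hr0 hr.2 hγ.le
      · have : Continuous fun r : ℝ ↦ (1 + γ) * (1 - r) ^ (1 - β) := by
          exact continuous_const.mul
            ((continuous_const.sub continuous_id).rpow_const fun _ ↦ Or.inr hβ1'.le)
        have h := this.tendsto 1
        simp only [sub_self, Real.zero_rpow hβ1'.ne', mul_zero] at h
        exact h.mono_left nhdsWithin_le_nhds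
    · have h1 : (1 : ℝ) - r ≠ 0 := (sub_pos.2 hr1).ne'
      exact (((continuousAt_const.sub (Real.continuousAt_rpow_const _ _ (Or.inr hγ.le))).mul
        ((continuousAt_const.sub continuousAt_id).rpow_const (Or.inl h1)))).continuousWithinAt
  have hderiv : ∀ r ∈ Set.Ioo (0 : ℝ) 1, HasDerivAt F
      (β * ((1 - r ^ γ) * (1 - r) ^ (-1 - β)) - γ * (r ^ (γ - 1) * (1 - r) ^ (1 - β - 1))) r := by
    intro r hr
    have h1 : (1 : ℝ) - r ≠ 0 := (sub_pos.2 hr.2).ne'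
    have hA := (Real.hasDerivAt_rpow_const (p := γ) (Or.inl hr.1.ne')).const_sub 1
    have hC := ((hasDerivAt_id r).const_sub 1).rpow_const (p := -β) (Or.inl h1)
    convert! hA.mul hC using 1
    simp only [id]
    rw [show -1 - β = -β - 1 by ring, show 1 - β - 1 = -β by ring]
    ring
  have key := intervalIntegral.integral_eq_sub_of_hasDerivAt_of_le zero_le_one hcont hderiv
    ((hI.const_mul β).sub (hB.const_mul γ))
  rw [intervalIntegral.integral_sub (hI.const_mul β) (hB.const_mul γ),
    intervalIntegral.integral_const_mul, intervalIntegral.integral_const_mul,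
    integral_betaIntegrand hγ hβ1'] at key
  have hF : F 1 - F 0 = -1 := by simp [F, Real.zero_rpow hγ.ne']
  rw [hF] at key
  rw [add_comm 1 γ, Real.Gamma_add_one hγ.ne', show γ + 1 - β = γ + (1 - β) by ring]
  linear_combination key

/-- The power series with coefficients `b k / Γ(1 + βk)`. -/
noncomputable def mlSeries (β : ℝ) (b : ℕ → ℝ) (y : ℝ) : ℝ :=
  ∑' k : ℕ, b k * y ^ k / Real.Gamma (1 + β * k)

lemma Gamma_one_add_mul_pos {β : ℝ} (hβ : 0 < β) (k : ℕ) : 0 < Real.Gamma (1 + β * k) :=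
  Real.Gamma_pos_of_pos (by positivity)

lemma norm_mlSeries_term_le {β : ℝ} (hβ : 0 < β) {b : ℕ → ℝ} {c : ℝ}
    (hb : ∀ k, |b k| ≤ c * 2 ^ k) {y R : ℝ} (hy : |y| ≤ R) (k : ℕ) :
    ‖b k * y ^ k / Real.Gamma (1 + β * k)‖ ≤ c * ((2 * R) ^ k / Real.Gamma (1 + β * k)) := by
  have hΓ := Gamma_one_add_mul_pos hβ k
  rw [norm_div, norm_mul, norm_pow, Real.norm_of_nonneg hΓ.le, Real.norm_eq_abs, Real.norm_eq_abs,
    mul_pow, ← mul_div_assoc, ← mul_assoc]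
  have := hb k
  have := (abs_nonneg _).trans this
  gcongr

lemma summable_mlSeries {β : ℝ} (hβ : 0 < β) {b : ℕ → ℝ} {c : ℝ}
    (hb : ∀ k, |b k| ≤ c * 2 ^ k) (y : ℝ) :
    Summable fun k : ℕ ↦ ‖b k * y ^ k / Real.Gamma (1 + β * k)‖ :=
  ((summable_pow_div_Gamma hβ (R := 2 * |y|) (by positivity)).mul_left c).of_nonneg_of_le
    (fun _ ↦ norm_nonneg _) (norm_mlSeries_term_le hβ hb le_rfl)

lemma continuousOn_mlSeries {β : ℝ} (hβ : 0 < β) {b : ℕ → ℝ} {c : ℝ}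
    (hb : ∀ k, |b k| ≤ c * 2 ^ k) {X : ℝ} (hX : 0 ≤ X) :
    ContinuousOn (mlSeries β b) (Set.Icc 0 X) :=
  continuousOn_tsum (fun k ↦ by fun_prop)
    ((summable_pow_div_Gamma hβ (R := 2 * X) (by positivity)).mul_left c)
    fun k y hy ↦ norm_mlSeries_term_le hβ hb (by rw [abs_of_nonneg hy.1]; exact hy.2) k

lemma mlSeries_zero (β : ℝ) (b : ℕ → ℝ) : mlSeries β b 0 = b 0 := by
  rw [mlSeries, tsum_eq_single 0 fun k hk ↦ by simp [hk]]
  simp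

/-- Fractional maximum principle: at a maximum over `[0, x]`, the Caputo derivative of
`t ↦ mlSeries β b (t ^ β)` is nonnegative. -/
lemma mlSeries_shift_nonneg_of_isMax {β : ℝ} (hβ : 0 < β) (hβ1 : β < 1) {b : ℕ → ℝ} {c : ℝ}
    (hb : ∀ k, |b k| ≤ c * 2 ^ k) {x : ℝ} (hx : 0 ≤ x)
    (hmax : ∀ y ∈ Set.Icc 0 x, mlSeries β b y ≤ mlSeries β b x) :
    0 ≤ x * mlSeries β (fun k ↦ b (k + 1)) x := by
  have hβ1' : 0 < 1 - β := sub_pos.2 hβ1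
  have hΓβ := Real.Gamma_pos_of_pos hβ1'
  set a : ℕ → ℝ := fun k ↦ b k * x ^ k / Real.Gamma (1 + β * k) with ha
  have hasum : Summable fun k ↦ ‖a k‖ := summable_mlSeries hβ hb x
  have hb' : ∀ k, |b (k + 1)| ≤ (2 * c) * 2 ^ k := fun k ↦ (hb (k + 1)).trans_eq (by ring)
  -- `d k` is the termwise Caputo derivative
  set d : ℕ → ℝ := fun k ↦ b k * x ^ k / Real.Gamma (1 + β * k - β) with hd
  have hd1 : ∀ k, d (k + 1) = x * (b (k + 1) * x ^ k / Real.Gamma (1 + β * k)) := fun k ↦ by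
    simp only [hd]
    push_cast
    rw [show 1 + β * ((k : ℝ) + 1) - β = 1 + β * k by ring]
    ring
  have hdsum : Summable fun k ↦ ‖d k‖ := by
    rw [← summable_nat_add_iff 1]
    simp only [hd1, norm_mul x]
    exact (summable_mlSeries hβ hb' x).mul_left _
  set w : ℝ → ℝ := fun r ↦ (1 - r) ^ (-1 - β)
  set F : ℕ → ℝ → ℝ := fun k r ↦ a k * ((1 - r ^ (β * k)) * w r) with hF
  have hJ : ∀ k : ℕ, β * ∫ r in Set.Ioo (0 : ℝ) 1, (1 - r ^ (β * k)) * w r =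
      Real.Gamma (1 - β) * Real.Gamma (1 + β * k) / Real.Gamma (1 + β * k - β) - 1 := fun k ↦ by
    rw [← integral_one_sub_rpow_mul hβ hβ1 (by positivity : 0 ≤ β * k),
      intervalIntegral.integral_of_le zero_le_one, integral_Ioc_eq_integral_Ioo]
  have hJint : ∀ k : ℕ, IntegrableOn (fun r ↦ (1 - r ^ (β * k)) * w r) (Set.Ioo 0 1) := fun k ↦
    (intervalIntegrable_iff_integrableOn_Ioo_of_le zero_le_one).1
      (intervalIntegrable_one_sub_rpow_mul hβ hβ1 (by positivity))
  have hJ0 : ∀ (k : ℕ), ∀ r ∈ Set.Ioo (0 : ℝ) 1, 0 ≤ (1 - r ^ (β * k)) * w r := fun k r hr ↦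
    mul_nonneg (sub_nonneg.2 (Real.rpow_le_one hr.1.le hr.2.le (by positivity)))
      (Real.rpow_nonneg (by linarith [hr.2]) _)
  have hFd : ∀ k, β * ∫ r in Set.Ioo (0 : ℝ) 1, F k r = Real.Gamma (1 - β) * d k - a k := fun k ↦ by
    have hΓ := (Gamma_one_add_mul_pos hβ k).ne'
    simp only [hF]
    rw [integral_const_mul, mul_left_comm, hJ]
    simp only [ha, hd]
    field_simp
  have hFnorm : ∀ k, ∫ r in Set.Ioo (0 : ℝ) 1, ‖F k r‖ =
      β⁻¹ * (Real.Gamma (1 - β) * ‖d k‖ - ‖a k‖) := fun k ↦ by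
    have hΓ := (Gamma_one_add_mul_pos hβ k).ne'
    have hΓd : 0 ≤ Real.Gamma (1 + β * k - β) := Real.Gamma_nonneg_of_nonneg <| by
      have : 0 ≤ β * k := by positivity
      linarith
    have hcongr : ∫ r in Set.Ioo (0 : ℝ) 1, ‖F k r‖ =
        ∫ r in Set.Ioo (0 : ℝ) 1, ‖a k‖ * ((1 - r ^ (β * k)) * w r) :=
      setIntegral_congr_fun measurableSet_Ioo fun r hr ↦ by
        simp only [hF, norm_mul (a k), Real.norm_of_nonneg (hJ0 k r hr)]
    rw [hcongr, integral_const_mul, eq_inv_mul_iff_mul_eq₀ hβ.ne', mul_left_comm, hJ]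
    simp only [ha, hd, norm_div, Real.norm_of_nonneg hΓd,
      Real.norm_of_nonneg (Gamma_one_add_mul_pos hβ k).le]
    field_simp
  have hsum := hasSum_integral_of_summable_integral_norm (F := F)
    (μ := volume.restrict (Set.Ioo 0 1)) (fun k ↦ (hJint k).const_mul _) (by
      simp only [hFnorm]
      exact ((hdsum.mul_left _).sub hasum).mul_left _)
  have hnonneg : 0 ≤ ∫ r in Set.Ioo (0 : ℝ) 1, ∑' k, F k r := by
    refine setIntegral_nonneg measurableSet_Ioo fun r hr ↦ ?_
    have hrβ : r ^ β ∈ Set.Icc (0 : ℝ) 1 :=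
      ⟨Real.rpow_nonneg hr.1.le _, Real.rpow_le_one hr.1.le hr.2.le hβ.le⟩
    have hy : x * r ^ β ∈ Set.Icc 0 x := ⟨mul_nonneg hx hrβ.1, mul_le_of_le_one_right hx hrβ.2⟩
    have : ∑' k, F k r = (mlSeries β b x - mlSeries β b (x * r ^ β)) * w r := by
      rw [mlSeries, mlSeries, ← (summable_mlSeries hβ hb x).of_norm.tsum_sub
        (summable_mlSeries hβ hb _).of_norm, ← tsum_mul_right]
      refine tsum_congr fun k ↦ ?_
      simp only [hF, ha]
      rw [mul_pow, ← Real.rpow_natCast (r ^ β), ← Real.rpow_mul hr.1.le]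
      ring
    rw [this]
    exact mul_nonneg (sub_nonneg.2 (hmax _ hy)) (Real.rpow_nonneg (by linarith [hr.2]) _)
  have htot : β * ∫ r in Set.Ioo (0 : ℝ) 1, ∑' k, F k r =
      Real.Gamma (1 - β) * ∑' k, d k - ∑' k, a k := by
    rw [← hsum.tsum_eq, ← tsum_mul_left, ← tsum_mul_left,
      ← (hdsum.of_norm.mul_left _).tsum_sub hasum.of_norm]
    exact tsum_congr hFd
  have hd0 : Real.Gamma (1 - β) * d 0 = mlSeries β b 0 := by
    rw [mlSeries_zero]
    simp [hd, hΓβ.ne', mul_div_cancel₀]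
  have hdt : ∑' k, d k = d 0 + x * mlSeries β (fun k ↦ b (k + 1)) x := by
    rw [hdsum.of_norm.tsum_eq_zero_add, mlSeries, ← tsum_mul_left]
    simp only [hd1]
  have h0 := hmax 0 ⟨le_rfl, hx⟩
  have : 0 ≤ Real.Gamma (1 - β) * (x * mlSeries β (fun k ↦ b (k + 1)) x) := by
    have h2 : ∑' k, a k = mlSeries β b x := rfl
    have h3 := mul_nonneg hβ.le hnonneg
    rw [htot, hdt, mul_add, hd0, h2] at h3
    linarith
  exact nonneg_of_mul_nonneg_right this hΓβ

lemma mlSeries_neg (β : ℝ) (b : ℕ → ℝ) (y : ℝ) :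
    mlSeries β (fun k ↦ -b k) y = -mlSeries β b y := by
  simp only [mlSeries, neg_mul, neg_div, tsum_neg]

lemma mlSeries_le {β : ℝ} (hβ : 0 < β) (hβ1 : β < 1) {b : ℕ → ℝ} {c M : ℝ}
    (hb : ∀ k, |b k| ≤ c * 2 ^ k) (hb0 : b 0 ≤ M)
    (h : ∀ x, 0 < x → 0 ≤ mlSeries β (fun k ↦ b (k + 1)) x → mlSeries β b x ≤ M)
    {x : ℝ} (hx : 0 ≤ x) : mlSeries β b x ≤ M := by
  obtain ⟨z, hz, hmax⟩ := isCompact_Icc.exists_isMaxOn (Set.nonempty_Icc.2 hx)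
    (continuousOn_mlSeries hβ hb hx)
  refine (hmax ⟨hx, le_rfl⟩).trans ?_
  rcases hz.1.eq_or_lt with rfl | hz0
  · exact (mlSeries_zero β b).trans_le hb0
  · refine h z hz0 (nonneg_of_mul_nonneg_right ?_ hz0)
    exact mlSeries_shift_nonneg_of_isMax hβ hβ1 hb hz0.le
      fun y hy ↦ hmax ⟨hy.1, hy.2.trans hz.2⟩

lemma abs_neg_one_pow_le (k : ℕ) : |(-1 : ℝ) ^ k| ≤ 1 * 2 ^ k := by
  simpa using one_le_pow₀ (one_le_two : (1 : ℝ) ≤ 2)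

lemma abs_mul_neg_one_pow_le (k : ℕ) : |(k : ℝ) * (-1) ^ k| ≤ 1 * 2 ^ k := by
  simpa [abs_mul] using (mod_cast Nat.lt_two_pow_self.le : (k : ℝ) ≤ 2 ^ k)

lemma mittagLeffler_neg (β x : ℝ) : mittagLeffler β (-x) = mlSeries β (fun k ↦ (-1) ^ k) x := by
  simp only [mittagLeffler, mlSeries, neg_pow x]

lemma mittagLeffler_neg_le_one {β : ℝ} (hβ : 0 < β) (hβ1 : β < 1) {x : ℝ} (hx : 0 ≤ x) :
    mittagLeffler β (-x) ≤ 1 := by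
  rw [mittagLeffler_neg]
  refine mlSeries_le hβ hβ1 abs_neg_one_pow_le (by simp) (fun y _ h ↦ ?_) hx
  simp only [pow_succ, mul_neg_one, mlSeries_neg] at h
  linarith

lemma mittagLeffler_neg_nonneg {β : ℝ} (hβ : 0 < β) (hβ1 : β < 1) {x : ℝ} (hx : 0 ≤ x) :
    0 ≤ mittagLeffler β (-x) := by
  rw [mittagLeffler_neg, ← neg_nonpos, ← mlSeries_neg]
  refine mlSeries_le hβ hβ1 (c := 1) (fun k ↦ ?_) (by simp) (fun y _ h ↦ ?_) hx
  · rw [abs_neg]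
    exact abs_neg_one_pow_le k
  · simp only [pow_succ, mul_neg_one, neg_neg] at h
    rw [mlSeries_neg]
    linarith

lemma mlSeries_mul_neg_one_pow_shift {β : ℝ} (hβ : 0 < β) (x : ℝ) :
    mlSeries β (fun k ↦ ((k + 1 : ℕ) : ℝ) * (-1) ^ (k + 1)) x =
      -(mlSeries β (fun k ↦ (k : ℝ) * (-1) ^ k) x + mittagLeffler β (-x)) := by
  rw [mittagLeffler_neg, mlSeries, mlSeries, mlSeries,
    ← (summable_mlSeries hβ abs_mul_neg_one_pow_le x).of_norm.tsum_add
      (summable_mlSeries hβ abs_neg_one_pow_le x).of_norm, ← tsum_neg]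
  refine tsum_congr fun k ↦ ?_
  push_cast
  ring

lemma abs_mlSeries_mul_neg_one_pow_le {β : ℝ} (hβ : 0 < β) (hβ1 : β < 1) {x : ℝ} (hx : 0 ≤ x) :
    |mlSeries β (fun k ↦ (k : ℝ) * (-1) ^ k) x| ≤ 1 := by
  refine abs_le'.2 ⟨?_, ?_⟩
  · refine mlSeries_le hβ hβ1 abs_mul_neg_one_pow_le (by simp) (fun y hy h ↦ ?_) hx
    rw [mlSeries_mul_neg_one_pow_shift hβ] at h
    linarith [mittagLeffler_neg_nonneg hβ hβ1 hy.le]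
  · rw [← mlSeries_neg]
    refine mlSeries_le hβ hβ1 (c := 1) (fun k ↦ ?_) (by simp) (fun y hy h ↦ ?_) hx
    · rw [abs_neg]
      exact abs_mul_neg_one_pow_le k
    · rw [mlSeries_neg, mlSeries_mul_neg_one_pow_shift hβ] at h
      rw [mlSeries_neg]
      linarith [mittagLeffler_neg_le_one hβ hβ1 hy.le]

lemma norm_deriv_mlSeries_term_le {β : ℝ} (hβ : 0 < β) {R y : ℝ} (hR : 1 ≤ R) (hy : |y| ≤ R)
    (k : ℕ) : ‖(-1) ^ k * (k * y ^ (k - 1)) / Real.Gamma (1 + β * k)‖ ≤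
      (2 * R) ^ k / Real.Gamma (1 + β * k) := by
  have hΓ := Gamma_one_add_mul_pos hβ k
  have hk : (k : ℝ) ≤ 2 ^ k := mod_cast Nat.lt_two_pow_self.le
  have hpow : |y| ^ (k - 1) ≤ R ^ k :=
    (pow_le_pow_left₀ (abs_nonneg y) hy _).trans (pow_le_pow_right₀ hR (Nat.sub_le k 1))
  rw [norm_div, Real.norm_of_nonneg hΓ.le]
  simp only [norm_mul, norm_pow, norm_neg, norm_one, one_pow, one_mul,
    Real.norm_eq_abs, Nat.abs_cast, mul_pow]
  gcongr

lemma hasDerivAt_mittagLeffler_neg {β : ℝ} (hβ : 0 < β) (y : ℝ) :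
    HasDerivAt (fun x ↦ mittagLeffler β (-x))
      (∑' k : ℕ, (-1) ^ k * (k * y ^ (k - 1)) / Real.Gamma (1 + β * k)) y := by
  simp only [mittagLeffler_neg, mlSeries]
  have hR : 1 ≤ |y| + 1 := by linarith [abs_nonneg y]
  refine hasDerivAt_tsum_of_isPreconnected (t := Metric.ball 0 (|y| + 1)) (y₀ := y)
    (summable_pow_div_Gamma hβ (R := 2 * (|y| + 1)) (by positivity)) Metric.isOpen_ball
    (convex_ball _ _).isPreconnected
    (fun k z _ ↦ ((hasDerivAt_pow k z).const_mul _).div_const _)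
    (fun k z hz ↦ norm_deriv_mlSeries_term_le hβ hR ?_ k) (by simp)
    (summable_mlSeries hβ abs_neg_one_pow_le y).of_norm (by simp)
  simpa using (mem_ball_zero_iff.1 hz).le

lemma exists_lipschitz_mittagLeffler_neg {β : ℝ} (hβ : 0 < β) (hβ1 : β < 1) :
    ∃ L : ℝ, 0 < L ∧ ∀ x y : ℝ, 0 ≤ x → 0 ≤ y →
      |mittagLeffler β (-x) - mittagLeffler β (-y)| ≤ L * |x - y| := by
  have hs := summable_pow_div_Gamma hβ (R := 2 * 1) (by norm_num)
  refine ⟨max 1 (∑' k : ℕ, (2 * 1 : ℝ) ^ k / Real.Gamma (1 + β * k)),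
    lt_max_of_lt_left one_pos, fun x y hx hy ↦ ?_⟩
  refine (convex_Ici (0 : ℝ)).norm_image_sub_le_of_norm_hasDerivWithin_le
    (fun z _ ↦ (hasDerivAt_mittagLeffler_neg hβ z).hasDerivWithinAt) (fun z (hz : 0 ≤ z) ↦ ?_) hy hx
  rcases le_total z 1 with hz1 | hz1
  · exact (tsum_of_norm_bounded hs.hasSum fun k ↦ norm_deriv_mlSeries_term_le hβ le_rfl
      (by rwa [abs_of_nonneg hz]) k).trans (le_max_right _ _)
  · refine le_trans ?_ (le_max_left _ _)
    have hmul : z * ∑' k : ℕ, (-1) ^ k * (k * z ^ (k - 1)) / Real.Gamma (1 + β * k) =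
        mlSeries β (fun k ↦ (k : ℝ) * (-1) ^ k) z := by
      rw [mlSeries, ← tsum_mul_left]
      refine tsum_congr fun k ↦ ?_
      rcases k with _ | k
      · simp
      · rw [Nat.add_sub_cancel, pow_succ z]
        ring
    have h1 := abs_mlSeries_mul_neg_one_pow_le hβ hβ1 hz
    rw [← hmul, abs_mul, abs_of_nonneg hz] at h1
    exact (le_mul_of_one_le_left (norm_nonneg _) hz1).trans h1

lemma exists_holder_mittagLeffler_neg {β η : ℝ} (hβ : 0 < β) (hβ1 : β < 1) (hη : 0 ≤ η)
    (hη1 : η ≤ 1) : ∃ L : ℝ, 0 < L ∧ ∀ x y : ℝ, 0 ≤ x → 0 ≤ y →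
      |mittagLeffler β (-x) - mittagLeffler β (-y)| ≤ (L * |x - y|) ^ η := by
  obtain ⟨L, hL, hlip⟩ := exists_lipschitz_mittagLeffler_neg hβ hβ1
  refine ⟨L, hL, fun x y hx hy ↦ ?_⟩
  rcases le_total (L * |x - y|) 1 with h | h
  · exact (hlip x y hx hy).trans (Real.self_le_rpow_of_le_one (by positivity) h hη1)
  · refine le_trans (abs_sub_le_iff.2 ⟨?_, ?_⟩) (Real.one_le_rpow h hη) <;>
    linarith [mittagLeffler_neg_nonneg hβ hβ1 hx, mittagLeffler_neg_nonneg hβ hβ1 hy,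
      mittagLeffler_neg_le_one hβ hβ1 hx, mittagLeffler_neg_le_one hβ hβ1 hy]

lemma abs_rpow_sub_rpow_le {β t s : ℝ} (hβ : 0 ≤ β) (hβ1 : β ≤ 1) (ht : 0 ≤ t) (hs : 0 ≤ s) :
    |t ^ β - s ^ β| ≤ |t - s| ^ β := by
  wlog h : s ≤ t generalizing t s
  · rw [abs_sub_comm, abs_sub_comm t]
    exact this hs ht (le_of_not_ge h)
  have h0 : 0 ≤ t - s := sub_nonneg.2 h
  rw [abs_of_nonneg (sub_nonneg.2 (Real.rpow_le_rpow hs h hβ)), abs_of_nonneg h0]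
  have := Real.rpow_add_le_add_rpow h0 hs hβ hβ1
  rw [sub_add_cancel] at this
  linarith

/-- Temporal mean-square Hölder continuity of the limit field of Theorem 3.1:
`∫_ℝ |G(λ)|² |E_β(-μt^β|λ|^α) - E_β(-μs^β|λ|^α)|² dλ ≤ C |t-s|^{2ηβ}`. -/
theorem limit_field_temporal_holder
    (β μ α η : ℝ) (hβ : β ∈ Set.Ioo (0 : ℝ) 1) (hμ : 0 < μ) (hα : 0 ≤ α)
    (hη : η ∈ Set.Ioc (0 : ℝ) 1)
    (G : ℝ → ℂ) (hG : Integrable (fun l : ℝ => ‖G l‖ ^ 2))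
    (hGη : Integrable (fun l : ℝ => |l| ^ (2 * α * η) * ‖G l‖ ^ 2)) :
    ∃ C : ℝ, 0 < C ∧ ∀ t s : ℝ, 0 < t → 0 < s →
      ∫ l : ℝ, ‖G l‖ ^ 2 *
          |mittagLeffler β (-(μ * t ^ β * |l| ^ α)) -
            mittagLeffler β (-(μ * s ^ β * |l| ^ α))| ^ 2 ≤
        C * |t - s| ^ (2 * η * β) := by
  obtain ⟨L, hL, hhol⟩ := exists_holder_mittagLeffler_neg hβ.1 hβ.2 hη.1.le hη.2
  have hI : 0 ≤ ∫ l : ℝ, |l| ^ (2 * α * η) * ‖G l‖ ^ 2 := integral_nonneg fun l ↦ by positivity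
  refine ⟨(L * μ) ^ (2 * η) * (∫ l : ℝ, |l| ^ (2 * α * η) * ‖G l‖ ^ 2) + 1, by positivity,
    fun t s ht hs ↦ ?_⟩
  have hη0 := hη.1.le
  have hβ0 := hβ.1.le
  have hbound : ∀ l : ℝ, ‖G l‖ ^ 2 * |mittagLeffler β (-(μ * t ^ β * |l| ^ α)) -
      mittagLeffler β (-(μ * s ^ β * |l| ^ α))| ^ 2 ≤
      (L * μ) ^ (2 * η) * |t - s| ^ (2 * η * β) * (|l| ^ (2 * α * η) * ‖G l‖ ^ 2) := fun l ↦ by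
    have hdiff : |μ * t ^ β * |l| ^ α - μ * s ^ β * |l| ^ α| ≤ μ * |t - s| ^ β * |l| ^ α := by
      rw [← sub_mul, ← mul_sub, abs_mul, abs_mul, abs_of_pos hμ,
        abs_of_nonneg (Real.rpow_nonneg (abs_nonneg l) α)]
      gcongr
      exact abs_rpow_sub_rpow_le hβ0 hβ.2.le ht.le hs.le
    have hml := hhol (μ * t ^ β * |l| ^ α) (μ * s ^ β * |l| ^ α) (by positivity) (by positivity)
    calc _ ≤ ‖G l‖ ^ 2 * ((L * (μ * |t - s| ^ β * |l| ^ α)) ^ η) ^ 2 := by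
          gcongr
          exact hml.trans (by gcongr)
      _ = ‖G l‖ ^ 2 * (L * μ * (|t - s| ^ β * |l| ^ α)) ^ (2 * η) := by
          rw [← Real.rpow_mul_natCast (by positivity) η 2]
          push_cast
          ring_nf
      _ = _ := by
          rw [Real.mul_rpow (x := L * μ) (by positivity) (by positivity),
            Real.mul_rpow (x := |t - s| ^ β) (by positivity) (by positivity),
            ← Real.rpow_mul (abs_nonneg _), ← Real.rpow_mul (abs_nonneg _),
            show β * (2 * η) = 2 * η * β by ring, show α * (2 * η) = 2 * α * η by ring]
          ring
  calc _ ≤ ∫ l : ℝ, (L * μ) ^ (2 * η) * |t - s| ^ (2 * η * β) *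
        (|l| ^ (2 * α * η) * ‖G l‖ ^ 2) :=
        integral_mono_of_nonneg (ae_of_all _ fun l ↦ by positivity) (hGη.const_mul _)
          (ae_of_all _ hbound)
    _ ≤ _ := by
        rw [integral_const_mul]
        have : 0 ≤ |t - s| ^ (2 * η * β) := by positivity
        linarith
end

section
/- Let β ∈ (0,1), μ > 0, α ≥ 0, and let ĝ : ℝ × ℝ → ℂ be measurable. Suppose there exist θ ∈ (0,1] and C₀ > 0 such that for all x, y ∈ ℝ, ∫_ℝ |ĝ(λ,x) − ĝ(λ,y)|² (1 + λ²)^{−α} dλ ≤ C₀ |x − y|^{2θ}. Then for every fixed t > 0 there exists C > 0 such that for all x, y ∈ ℝ, ∫_ℝ |ĝ(λ,x) − ĝ(λ,y)|² (E_β(−μ t^β |λ|^α))² dλ ≤ C |x − y|^{2θ}. (This expresses, via the Itô isometry, that the limit field U₀^g(t,x) of Theorem 3.1 is mean-square Hölder continuous in the spatial variable of any order γ_x ∈ (0,θ).) -/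
open Real MeasureTheory

lemma intervalIntegrable_sub_rpow_mul {β : ℝ} (hβ : 0 < β) {d : ℝ → ℝ} (hd : Continuous d)
    (T a b : ℝ) : IntervalIntegrable (fun s => (T - s) ^ (β - 1) * d s) volume a b := by
  refine IntervalIntegrable.mul_continuousOn ?_ hd.continuousOn
  have h := (intervalIntegral.intervalIntegrable_rpow' (a := T - a) (b := T - b)
    (r := β - 1) (by linarith)).comp_sub_left T
  simpa using h

lemma integral_sub_rpow {β : ℝ} (hβ : 0 < β) (a t : ℝ) :
    ∫ s in a..t, (t - s) ^ (β - 1) = (t - a) ^ β / β := by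
  rw [intervalIntegral.integral_comp_sub_left (fun x : ℝ => x ^ (β - 1)) t,
    integral_rpow (Or.inl (by linarith))]
  simp [Real.zero_rpow hβ.ne']

/-- A positivity principle for the Volterra equation with kernel `c * r ^ (β - 1)`. -/
lemma volterra_pos {β c : ℝ} (hβ : 0 < β) (hβ1 : β < 1) (hc : 0 < c) {d f : ℝ → ℝ}
    (hd : Continuous d) (hd0 : 0 < d 0)
    (hV : ∀ t, 0 ≤ t → d t + c * ∫ s in 0..t, (t - s) ^ (β - 1) * d s = f t)
    (hf : ∀ t T, 0 < t → t < T → (T / t) ^ (β - 1) * f t ≤ f T) :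
    ∀ t, 0 ≤ t → 0 < d t := by
  by_contra! hcon
  set S := {t : ℝ | 0 ≤ t ∧ d t ≤ 0} with hS
  have hSne : S.Nonempty := hcon
  have hSbdd : BddBelow S := ⟨0, fun t ht => ht.1⟩
  have hScl : IsClosed S :=
    isClosed_Ici.inter (isClosed_le hd continuous_const)
  have hmem : sInf S ∈ S := hScl.csInf_mem hSne hSbdd
  set T := sInf S with hT
  have hT0 : 0 < T := lt_of_le_of_ne hmem.1 fun h => by
    have := hmem.2
    rw [← h] at this
    linarith
  have hpos : ∀ t, 0 ≤ t → t < T → 0 < d t := fun t ht htT => by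
    by_contra! h
    exact absurd (csInf_le hSbdd (show t ∈ S from ⟨ht, h⟩)) (not_le.2 htT)
  obtain ⟨δ, hδ0, hδT, hδ⟩ : ∃ δ, 0 < δ ∧ δ ≤ T / 2 ∧ c * (δ ^ β / β) < 1 / 2 := by
    have h1 : Filter.Tendsto (fun δ : ℝ => c * (δ ^ β / β)) (nhdsWithin 0 (Set.Ioi 0))
        (nhds 0) := by
      have : Continuous fun δ : ℝ => c * (δ ^ β / β) := by
        have := Real.continuous_rpow_const hβ.le
        fun_prop
      have h2 := this.tendsto 0
      simp only [Real.zero_rpow hβ.ne', zero_div, mul_zero] at h2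
      exact h2.mono_left nhdsWithin_le_nhds
    have h3 := h1.eventually (gt_mem_nhds (show (0 : ℝ) < 1 / 2 by norm_num))
    have h4 : ∀ᶠ δ : ℝ in nhdsWithin 0 (Set.Ioi 0), δ ∈ Set.Ioo 0 (T / 2) :=
      Ioo_mem_nhdsGT (by linarith)
    obtain ⟨δ, ha, hb⟩ := (h3.and h4).exists
    exact ⟨δ, hb.1, hb.2.le, ha⟩
  obtain ⟨m, hmI, hmax⟩ := isCompact_Icc.exists_isMaxOn
    (Set.nonempty_Icc.2 (show T - δ ≤ T by linarith)) hd.continuousOn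
  have hdm : 0 < d m :=
    lt_of_lt_of_le (hpos (T - δ) (by linarith) (by linarith))
      (hmax (Set.left_mem_Icc.2 (by linarith)))
  have hmT : m < T := lt_of_le_of_ne hmI.2 fun h => by
    rw [h] at hdm
    exact absurd hmem.2 (not_le.2 hdm)
  have hm0 : 0 < m := by linarith [hmI.1]
  set ρ := (T / m) ^ (β - 1) with hρ
  have hρ0 : 0 < ρ := by positivity
  have hρ2 : 1 / 2 ≤ ρ := by
    have h1 : (T / m) ^ (-1 : ℝ) ≤ ρ :=
      Real.rpow_le_rpow_of_exponent_le ((one_le_div hm0).2 hmT.le) (by linarith)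
    rw [Real.rpow_neg_one, inv_div] at h1
    refine le_trans ?_ h1
    rw [div_le_div_iff₀ (by norm_num) hT0]
    linarith [hmI.1]
  have hVm := hV m hm0.le
  have hVT := hV T hT0.le
  have hsplit := intervalIntegral.integral_add_adjacent_intervals
    (intervalIntegrable_sub_rpow_mul hβ hd T 0 m) (intervalIntegrable_sub_rpow_mul hβ hd T m T)
  have hA : ∫ s in 0..m, (T - s) ^ (β - 1) * d s
      ≤ ρ * ∫ s in 0..m, (m - s) ^ (β - 1) * d s := by
    rw [← intervalIntegral.integral_const_mul]
    refine intervalIntegral.integral_mono_on_of_le_Ioo hm0.le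
      (intervalIntegrable_sub_rpow_mul hβ hd T 0 m)
      ((intervalIntegrable_sub_rpow_mul hβ hd m 0 m).const_mul ρ) fun s hs => ?_
    rw [← mul_assoc]
    refine mul_le_mul_of_nonneg_right ?_ (hpos s hs.1.le (hs.2.trans hmT)).le
    have h1 : 0 < m - s := by linarith [hs.2]
    rw [hρ, ← Real.mul_rpow (by positivity) h1.le]
    refine Real.rpow_le_rpow_of_nonpos (by positivity) ?_ (by linarith)
    rw [div_mul_eq_mul_div, div_le_iff₀ hm0]
    nlinarith [hs.1]
  have hB : ∫ s in m..T, (T - s) ^ (β - 1) * d s ≤ δ ^ β / β * d m := by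
    calc ∫ s in m..T, (T - s) ^ (β - 1) * d s
        ≤ ∫ s in m..T, (T - s) ^ (β - 1) * d m := by
          refine intervalIntegral.integral_mono_on hmT.le
            (intervalIntegrable_sub_rpow_mul hβ hd T m T)
            (intervalIntegrable_sub_rpow_mul hβ continuous_const T m T) fun s hs => ?_
          refine mul_le_mul_of_nonneg_left (hmax ⟨by linarith [hs.1, hmI.1], hs.2⟩) ?_
          exact Real.rpow_nonneg (by linarith [hs.2]) _
      _ = (T - m) ^ β / β * d m := by
          rw [intervalIntegral.integral_mul_const, integral_sub_rpow hβ]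
      _ ≤ δ ^ β / β * d m := by
          have : T - m ≤ δ := by linarith [hmI.1]
          have : 0 ≤ T - m := by linarith
          gcongr
  have hfm := hf m T hm0 hmT
  have hc1 := mul_le_mul_of_nonneg_left hA hc.le
  have hc2 := mul_le_mul_of_nonneg_left hB hc.le
  rw [← hsplit, mul_add] at hVT
  rw [← hVm] at hfm
  have := hmem.2
  nlinarith [mul_lt_mul_of_pos_right hδ hdm, mul_le_mul_of_nonneg_right hρ2 hdm.le]

lemma volterra_antitone {β c : ℝ} (hβ : 0 < β) (hβ1 : β < 1) (hc : 0 < c) {u : ℝ → ℝ}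
    (hu : Continuous u)
    (hV : ∀ t, 0 ≤ t → u t + c * ∫ s in 0..t, (t - s) ^ (β - 1) * u s = 1) :
    (∀ t, 0 ≤ t → 0 < u t) ∧ AntitoneOn u (Set.Ici 0) := by
  have hu0 : u 0 = 1 := by simpa using hV 0 le_rfl
  have hpos : ∀ t, 0 ≤ t → 0 < u t := by
    refine volterra_pos (f := fun _ => 1) hβ hβ1 hc hu (by simp [hu0]) hV fun t T ht htT => ?_
    rw [mul_one]
    exact Real.rpow_le_one_of_one_le_of_nonpos ((one_le_div ht).2 htT.le) (by linarith)
  refine ⟨hpos, fun a ha b hb hab => ?_⟩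
  rcases hab.eq_or_lt with rfl | hab
  · exact le_rfl
  have ha : 0 ≤ a := ha
  obtain ⟨h, hh⟩ : ∃ h, h = b - a := ⟨_, rfl⟩
  have hh0 : 0 < h := by linarith
  have key := volterra_pos (d := fun t => u t - u (t + h))
    (f := fun t => c * ∫ s in 0..h, (t + h - s) ^ (β - 1) * u s) hβ hβ1 hc
    (by fun_prop) ?_ ?_ ?_ a ha
  · have hb' : a + h = b := by linarith
    simp only [hb'] at key
    linarith
  · have h1 := hV h hh0.le
    have h2 : 0 < ∫ s in 0..h, (h - s) ^ (β - 1) * u s := by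
      refine intervalIntegral.intervalIntegral_pos_of_pos_on
        (intervalIntegrable_sub_rpow_mul hβ hu h 0 h) (fun s hs => ?_) hh0
      exact mul_pos (Real.rpow_pos_of_pos (by linarith [hs.2]) _) (hpos s hs.1.le)
    simp only [zero_add, hu0]
    nlinarith
  · intro t ht
    have h1 := hV t ht
    have h2 := hV (t + h) (by linarith)
    have h3 := intervalIntegral.integral_add_adjacent_intervals
      (intervalIntegrable_sub_rpow_mul hβ hu (t + h) 0 h)
      (intervalIntegrable_sub_rpow_mul hβ hu (t + h) h (t + h))
    have h4 : ∫ s in 0..t, (t - s) ^ (β - 1) * u (s + h)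
        = ∫ s in h..(t + h), (t + h - s) ^ (β - 1) * u s := by
      have := intervalIntegral.integral_comp_add_right (a := 0) (b := t)
        (fun s => (t + h - s) ^ (β - 1) * u s) h
      simpa using this
    have h5 : ∫ s in 0..t, (t - s) ^ (β - 1) * (u s - u (s + h))
        = (∫ s in 0..t, (t - s) ^ (β - 1) * u s)
          - ∫ s in 0..t, (t - s) ^ (β - 1) * u (s + h) := by
      simp only [mul_sub]
      exact intervalIntegral.integral_sub (intervalIntegrable_sub_rpow_mul hβ hu t 0 t)
        (intervalIntegrable_sub_rpow_mul hβ (d := fun s => u (s + h)) (by fun_prop) t 0 t)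
    simp only [h5, h4]
    rw [← h3] at h2
    linarith
  · intro t T ht htT
    have h1 : (T / t) ^ (β - 1) * ∫ s in 0..h, (t + h - s) ^ (β - 1) * u s
        ≤ ∫ s in 0..h, (T + h - s) ^ (β - 1) * u s := by
      rw [← intervalIntegral.integral_const_mul]
      refine intervalIntegral.integral_mono_on hh0.le
        ((intervalIntegrable_sub_rpow_mul hβ hu (t + h) 0 h).const_mul _)
        (intervalIntegrable_sub_rpow_mul hβ hu (T + h) 0 h) fun s hs => ?_
      rw [← mul_assoc]
      refine mul_le_mul_of_nonneg_right ?_ (hpos s hs.1).le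
      have h2 : 0 < t + h - s := by linarith [hs.2]
      have h3 : 0 < T := by linarith
      rw [← Real.mul_rpow (by positivity) h2.le]
      refine Real.rpow_le_rpow_of_nonpos (by linarith [hs.2]) ?_ (by linarith)
      rw [div_mul_eq_mul_div, le_div_iff₀ ht]
      nlinarith [hs.2]
    have := mul_le_mul_of_nonneg_left h1 hc.le
    linarith

/-- Two-sided bounds of order `(1 + t ^ β)⁻¹` for solutions of the Volterra equation. -/
lemma volterra_bounds {β c : ℝ} (hβ : 0 < β) (hβ1 : β < 1) (hc : 0 < c) {u : ℝ → ℝ}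
    (hu : Continuous u)
    (hV : ∀ t, 0 ≤ t → u t + c * ∫ s in 0..t, (t - s) ^ (β - 1) * u s = 1) :
    ∃ A B : ℝ, 0 < A ∧ 0 < B ∧ ∀ t, 0 ≤ t → 1 ≤ A * (u t * (1 + t ^ β)) ∧
      u t * (1 + t ^ β) ≤ B := by
  obtain ⟨hpos, hanti⟩ := volterra_antitone hβ hβ1 hc hu hV
  have hu0 : u 0 = 1 := by simpa using hV 0 le_rfl
  obtain ⟨M, hM0, hM⟩ : ∃ M : ℝ, 0 < M ∧ M ^ (β - 1) = 1 / 2 := by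
    refine ⟨(1 / 2 : ℝ) ^ (β - 1)⁻¹, by positivity, ?_⟩
    rw [← Real.rpow_mul (by norm_num), inv_mul_cancel₀ (by linarith), Real.rpow_one]
  refine ⟨2 * (1 + c * M ^ β / β), 1 + β / c, by positivity, by positivity, fun t ht => ⟨?_, ?_⟩⟩
  · rcases ht.eq_or_lt with rfl | ht
    · have : 0 < c * M ^ β / β := by positivity
      rw [hu0, Real.zero_rpow hβ.ne']
      linarith
    set T := t + M * t with hT
    have hMt : 0 < M * t := by positivity
    have hVt := hV t ht.le
    have hVT := hV T (by linarith)
    rw [← intervalIntegral.integral_add_adjacent_intervals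
      (intervalIntegrable_sub_rpow_mul hβ hu T 0 t)
      (intervalIntegrable_sub_rpow_mul hβ hu T t T)] at hVT
    have h1 : ∫ s in 0..t, (T - s) ^ (β - 1) * u s
        ≤ 1 / 2 * ∫ s in 0..t, (t - s) ^ (β - 1) * u s := by
      rw [← intervalIntegral.integral_const_mul]
      refine intervalIntegral.integral_mono_on_of_le_Ioo ht.le
        (intervalIntegrable_sub_rpow_mul hβ hu T 0 t)
        ((intervalIntegrable_sub_rpow_mul hβ hu t 0 t).const_mul _) fun s hs => ?_
      rw [← mul_assoc]
      refine mul_le_mul_of_nonneg_right ?_ (hpos s hs.1.le).le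
      have h2 : 0 < t - s := by linarith [hs.2]
      rw [← hM, ← Real.mul_rpow hM0.le h2.le]
      refine Real.rpow_le_rpow_of_nonpos (by positivity) ?_ (by linarith)
      nlinarith [hs.1]
    have h2 : ∫ s in t..T, (T - s) ^ (β - 1) * u s ≤ M ^ β * t ^ β / β * u t := by
      calc ∫ s in t..T, (T - s) ^ (β - 1) * u s
          ≤ ∫ s in t..T, (T - s) ^ (β - 1) * u t := by
            refine intervalIntegral.integral_mono_on (by linarith)
              (intervalIntegrable_sub_rpow_mul hβ hu T t T)
              (intervalIntegrable_sub_rpow_mul hβ continuous_const T t T) fun s hs => ?_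
            refine mul_le_mul_of_nonneg_left
              (hanti (Set.mem_Ici.2 ht.le) (Set.mem_Ici.2 (ht.le.trans hs.1)) hs.1) ?_
            exact Real.rpow_nonneg (by linarith [hs.2]) _
        _ = M ^ β * t ^ β / β * u t := by
            rw [intervalIntegral.integral_mul_const, integral_sub_rpow hβ, hT,
              add_sub_cancel_left, Real.mul_rpow hM0.le ht.le]
    have h3 : u T ≤ u t :=
      hanti (Set.mem_Ici.2 ht.le) (Set.mem_Ici.2 (by linarith)) (by linarith)
    have h4 := mul_le_mul_of_nonneg_left h1 hc.le
    have h5 := mul_le_mul_of_nonneg_left h2 hc.le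
    have h6 := hpos t ht.le
    have h7 : 1 ≤ 2 * u t * (1 + c * M ^ β / β * t ^ β) := by
      have : c * (M ^ β * t ^ β / β * u t) = u t * (c * M ^ β / β * t ^ β) := by ring
      rw [this] at h5
      linarith
    refine h7.trans ?_
    have h8 : 0 ≤ u t * (t ^ β) := by positivity
    have h9 : 0 ≤ u t * (c * M ^ β / β) := by positivity
    nlinarith
  · have h1 : t ^ β / β * u t ≤ ∫ s in 0..t, (t - s) ^ (β - 1) * u s := by
      calc t ^ β / β * u t = ∫ s in 0..t, (t - s) ^ (β - 1) * u t := by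
            rw [intervalIntegral.integral_mul_const, integral_sub_rpow hβ, sub_zero]
        _ ≤ _ := by
            refine intervalIntegral.integral_mono_on ht
              (intervalIntegrable_sub_rpow_mul hβ continuous_const t 0 t)
              (intervalIntegrable_sub_rpow_mul hβ hu t 0 t) fun s hs => ?_
            refine mul_le_mul_of_nonneg_left
              (hanti (Set.mem_Ici.2 hs.1) (Set.mem_Ici.2 ht) hs.2) ?_
            exact Real.rpow_nonneg (by linarith [hs.2]) _
    have h2 := mul_le_mul_of_nonneg_left h1 hc.le
    have h3 := hV t ht
    have h4 := hpos t ht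
    have h5 : u t + c * (t ^ β / β * u t) ≤ 1 := by linarith
    have h6 : c * (t ^ β / β * u t) ≤ 1 := by linarith
    have h7 : u t ≤ 1 := by
      have : 0 ≤ c * (t ^ β / β * u t) := by positivity
      linarith
    have h8 : u t * t ^ β = β / c * (c * (t ^ β / β * u t)) := by field_simp
    have h9 : β / c * (c * (t ^ β / β * u t)) ≤ β / c * 1 := by gcongr
    rw [mul_add, h8]
    linarith

lemma rpow_mul_Gamma_le_Gamma_add {β s : ℝ} (hβ : 0 < β) (hβ1 : β < 1) (hs : 1 ≤ s) :
    (s + β - 1) ^ β * Real.Gamma s ≤ Real.Gamma (s + β) := by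
  have hp : 0 < s + β - 1 := by linarith
  have hG : 0 < Real.Gamma (s + β - 1) := Real.Gamma_pos_of_pos hp
  have h := Real.Gamma_mul_add_mul_le_rpow_Gamma_mul_rpow_Gamma
    (s := s + β) (t := s + β - 1) (a := 1 - β) (b := β) (by linarith) hp (by linarith) hβ
    (by ring)
  have he : (1 - β) * (s + β) + β * (s + β - 1) = s := by ring
  have hrec : Real.Gamma (s + β) = (s + β - 1) * Real.Gamma (s + β - 1) := by
    have := Real.Gamma_add_one hp.ne'
    rwa [sub_add_cancel] at this
  rw [he] at h
  calc (s + β - 1) ^ β * Real.Gamma s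
      ≤ (s + β - 1) ^ β * (Real.Gamma (s + β) ^ (1 - β) * Real.Gamma (s + β - 1) ^ β) := by
        gcongr
    _ = Real.Gamma (s + β) ^ (1 - β) * Real.Gamma (s + β) ^ β := by
        rw [mul_left_comm, ← Real.mul_rpow hp.le hG.le, ← hrec]
    _ = Real.Gamma (s + β) := by
        rw [← Real.rpow_add (Real.Gamma_pos_of_pos (by linarith)), sub_add_cancel, Real.rpow_one]

lemma summable_mittagLeffler {β : ℝ} (hβ : 0 < β) (hβ1 : β < 1) (x : ℝ) :
    Summable fun k : ℕ => x ^ k / Real.Gamma (1 + β * k) := by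
  rcases eq_or_ne x 0 with rfl | hx
  · refine summable_of_ne_finset_zero (s := {0}) fun k hk => ?_
    rw [Finset.mem_singleton] at hk
    simp [hk]
  refine summable_of_ratio_test_tendsto_lt_one (l := 0) one_pos
    (Filter.Eventually.of_forall fun k =>
      div_ne_zero (pow_ne_zero _ hx) (Gamma_one_add_mul_pos hβ k).ne') ?_
  have hlim : Filter.Tendsto (fun k : ℕ => |x| * (((k : ℝ) + 1) * β) ^ (-β)) Filter.atTop
      (nhds 0) := by
    have h1 : Filter.Tendsto (fun k : ℕ => ((k : ℝ) + 1) * β) Filter.atTop Filter.atTop :=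
      (Filter.tendsto_atTop_add_const_right _ _ tendsto_natCast_atTop_atTop).atTop_mul_const hβ
    simpa using ((tendsto_rpow_neg_atTop hβ).comp h1).const_mul |x|
  refine squeeze_zero (fun k => by positivity) (fun k => ?_) hlim
  have hG := Gamma_one_add_mul_pos hβ k
  have hG1 := Gamma_one_add_mul_pos hβ (k + 1)
  have hle := rpow_mul_Gamma_le_Gamma_add (s := 1 + β * k) hβ hβ1
    (le_add_of_nonneg_right (by positivity))
  have e1 : 1 + β * (k : ℝ) + β = 1 + β * ((k + 1 : ℕ) : ℝ) := by push_cast; ring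
  have e2 : 1 + β * (k : ℝ) + β - 1 = ((k : ℝ) + 1) * β := by ring
  rw [e2, e1] at hle
  have hp : 0 < (((k : ℝ) + 1) * β) ^ β := by positivity
  have hx' : 0 < |x| := abs_pos.2 hx
  rw [norm_div, norm_div, norm_pow, norm_pow, Real.norm_eq_abs, Real.norm_of_nonneg hG.le,
    Real.norm_of_nonneg hG1.le, Real.rpow_neg (by positivity), ← div_eq_mul_inv]
  have e3 : |x| ^ (k + 1) / Real.Gamma (1 + β * ((k + 1 : ℕ) : ℝ))
      / (|x| ^ k / Real.Gamma (1 + β * k))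
      = |x| * Real.Gamma (1 + β * k) / Real.Gamma (1 + β * ((k + 1 : ℕ) : ℝ)) := by
    field_simp
    ring
  rw [e3, div_le_div_iff₀ hG1 hp, mul_assoc, mul_comm (Real.Gamma _)]
  gcongr

lemma continuous_mittagLeffler {β : ℝ} (hβ : 0 < β) (hβ1 : β < 1) :
    Continuous (mittagLeffler β) := by
  rw [continuous_iff_continuousAt]
  intro x
  have h : ContinuousOn (mittagLeffler β) (Metric.ball 0 (|x| + 1)) := by
    refine continuousOn_tsum (fun k => by fun_prop) (summable_mittagLeffler hβ hβ1 (|x| + 1))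
      fun k y hy => ?_
    rw [norm_div, norm_pow, Real.norm_of_nonneg (Gamma_one_add_mul_pos hβ k).le]
    have : ‖y‖ ≤ |x| + 1 := by simpa using (mem_ball_zero_iff.1 hy).le
    have := Gamma_one_add_mul_pos hβ k
    gcongr
  exact h.continuousAt (Metric.isOpen_ball.mem_nhds (by simp))

lemma integral_sub_rpow_mul_rpow {a b t : ℝ} (ha : 0 < a) (hb : 0 < b) (ht : 0 < t) :
    ∫ s in 0..t, (t - s) ^ (b - 1) * s ^ (a - 1)
      = t ^ (a + b - 1) * (Real.Gamma a * Real.Gamma b / Real.Gamma (a + b)) := by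
  have h := Complex.betaIntegral_scaled a b ht
  rw [Complex.betaIntegral_eq_Gamma_mul_div _ _ (by simpa) (by simpa)] at h
  have h2 : ∫ x in 0..t, (x : ℂ) ^ ((a : ℂ) - 1) * ((t : ℂ) - x) ^ ((b : ℂ) - 1)
      = ∫ x in 0..t, (((t - x) ^ (b - 1) * x ^ (a - 1) : ℝ) : ℂ) := by
    refine intervalIntegral.integral_congr fun x hx => ?_
    rw [Set.uIcc_of_le ht.le] at hx
    have : 0 ≤ t - x := by linarith [hx.2]
    push_cast [Complex.ofReal_cpow hx.1, Complex.ofReal_cpow this]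
    ring
  rw [h2, intervalIntegral.integral_ofReal, ← Complex.ofReal_add, Complex.Gamma_ofReal,
    Complex.Gamma_ofReal, Complex.Gamma_ofReal, ← Complex.ofReal_one, ← Complex.ofReal_sub,
    ← Complex.ofReal_cpow ht.le] at h
  exact_mod_cast h

/-- `t ↦ E_β(-t ^ β)` solves a Volterra equation. -/
lemma mittagLeffler_volterra {β : ℝ} (hβ : 0 < β) (hβ1 : β < 1) {t : ℝ} (ht : 0 ≤ t) :
    mittagLeffler β (-t ^ β) + (Real.Gamma β)⁻¹ *
      ∫ s in 0..t, (t - s) ^ (β - 1) * mittagLeffler β (-s ^ β) = 1 := by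
  have hsum := summable_mittagLeffler hβ hβ1
  have hΓ : 0 < Real.Gamma β := Real.Gamma_pos_of_pos hβ
  have hzero : mittagLeffler β (-t ^ β)
      = 1 + ∑' k : ℕ, (-t ^ β) ^ (k + 1) / Real.Gamma (1 + β * ((k + 1 : ℕ) : ℝ)) := by
    rw [mittagLeffler, (hsum _).tsum_eq_zero_add]
    simp
  rcases ht.eq_or_lt with rfl | ht
  · rw [hzero]
    simp [Real.zero_rpow hβ.ne']
  have hcont : Continuous fun s : ℝ => s ^ β := Real.continuous_rpow_const hβ.le
  set F : ℕ → ℝ → ℝ := fun k s =>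
    (t - s) ^ (β - 1) * ((-s ^ β) ^ k / Real.Gamma (1 + β * k)) with hF
  have hFint : ∀ k, IntervalIntegrable (F k) volume 0 t := fun k =>
    intervalIntegrable_sub_rpow_mul hβ (by fun_prop) t 0 t
  have hbase : ∀ k : ℕ, ∫ s in 0..t, (t - s) ^ (β - 1) * ((s ^ β) ^ k / Real.Gamma (1 + β * k))
      = Real.Gamma β * ((t ^ β) ^ (k + 1) / Real.Gamma (1 + β * ((k + 1 : ℕ) : ℝ))) := by
    intro k
    have hG := Gamma_one_add_mul_pos hβ k
    have h1 := integral_sub_rpow_mul_rpow (a := 1 + β * k) (b := β) (by positivity) hβ ht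
    have h2 : ∫ s in 0..t, (t - s) ^ (β - 1) * ((s ^ β) ^ k / Real.Gamma (1 + β * k))
        = ∫ s in 0..t,
          (Real.Gamma (1 + β * k))⁻¹ * ((t - s) ^ (β - 1) * s ^ (1 + β * (k : ℝ) - 1)) := by
      refine intervalIntegral.integral_congr fun s hs => ?_
      rw [Set.uIcc_of_le ht.le] at hs
      rw [add_sub_cancel_left, Real.rpow_mul hs.1, Real.rpow_natCast]
      ring
    have e1 : 1 + β * (k : ℝ) + β = 1 + β * ((k + 1 : ℕ) : ℝ) := by push_cast; ring
    have e2 : 1 + β * ((k + 1 : ℕ) : ℝ) - 1 = β * ((k + 1 : ℕ) : ℝ) := by ring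
    rw [h2, intervalIntegral.integral_const_mul, h1, e1, e2, Real.rpow_mul ht.le,
      Real.rpow_natCast]
    field_simp
  have hint : ∀ k : ℕ, ∫ s in 0..t, F k s
      = -(Real.Gamma β * ((-t ^ β) ^ (k + 1) / Real.Gamma (1 + β * ((k + 1 : ℕ) : ℝ)))) := by
    intro k
    have h1 : F k = fun s => (-1) ^ k *
        ((t - s) ^ (β - 1) * ((s ^ β) ^ k / Real.Gamma (1 + β * k))) := by
      funext s
      rw [hF]
      simp only
      rw [neg_pow (s ^ β)]
      ring
    rw [h1, intervalIntegral.integral_const_mul, hbase, neg_pow (t ^ β) (k + 1)]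
    ring
  have hnorm : ∀ k : ℕ, ∫ s in Set.Ioc 0 t, ‖F k s‖
      = Real.Gamma β * ((t ^ β) ^ (k + 1) / Real.Gamma (1 + β * ((k + 1 : ℕ) : ℝ))) := by
    intro k
    rw [← hbase, intervalIntegral.integral_of_le ht.le]
    refine setIntegral_congr_fun measurableSet_Ioc fun s hs => ?_
    have hG := Gamma_one_add_mul_pos hβ k
    have h1 : 0 ≤ t - s := by linarith [hs.2]
    have h2 : 0 ≤ s ^ β := Real.rpow_nonneg hs.1.le _
    simp only [hF]
    rw [norm_mul, norm_div, norm_pow, norm_neg, Real.norm_of_nonneg hG.le,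
      Real.norm_of_nonneg h2, Real.norm_of_nonneg (Real.rpow_nonneg h1 _)]
  have hS : Summable fun k : ℕ => ∫ s in Set.Ioc 0 t, ‖F k s‖ := by
    simp only [hnorm]
    exact ((summable_nat_add_iff 1).2 (hsum (t ^ β))).mul_left _
  have hH := hasSum_integral_of_summable_integral_norm
    (fun k => (intervalIntegrable_iff_integrableOn_Ioc_of_le ht.le).1 (hFint k)) hS
  have hE : ∫ s in 0..t, (t - s) ^ (β - 1) * mittagLeffler β (-s ^ β)
      = ∫ s in Set.Ioc 0 t, ∑' k, F k s := by
    rw [intervalIntegral.integral_of_le ht.le]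
    simp only [hF, tsum_mul_left, mittagLeffler]
  rw [hE, ← hH.tsum_eq, hzero]
  simp only [← intervalIntegral.integral_of_le ht.le, hint]
  rw [tsum_neg, tsum_mul_left]
  field_simp
  ring

lemma mittagLeffler_neg_bounds {β : ℝ} (hβ : 0 < β) (hβ1 : β < 1) :
    ∃ A B : ℝ, 0 < A ∧ 0 < B ∧ ∀ x, 0 ≤ x → 1 ≤ A * (mittagLeffler β (-x) * (1 + x)) ∧
      mittagLeffler β (-x) * (1 + x) ≤ B := by
  have hcont : Continuous fun s : ℝ => s ^ β := Real.continuous_rpow_const hβ.le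
  obtain ⟨A, B, hA, hB, h⟩ := volterra_bounds (u := fun t => mittagLeffler β (-t ^ β)) hβ hβ1
    (inv_pos.2 (Real.Gamma_pos_of_pos hβ)) ((continuous_mittagLeffler hβ hβ1).comp hcont.neg)
    (fun t ht => mittagLeffler_volterra hβ hβ1 ht)
  refine ⟨A, B, hA, hB, fun x hx => ?_⟩
  have := h (x ^ β⁻¹) (Real.rpow_nonneg hx _)
  simpa only [Real.rpow_inv_rpow hx hβ.ne'] using this

/-- `1 + m |l| ^ α` and `(1 + l ^ 2) ^ (α / 2)` are comparable. -/
lemma one_add_mul_rpow_comparable {α m : ℝ} (hα : 0 ≤ α) (hm : 0 < m) (l : ℝ) :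
    (1 + l ^ 2) ^ (α / 2) ≤ 2 ^ (α / 2) * (1 + m⁻¹) * (1 + m * |l| ^ α) ∧
      1 + m * |l| ^ α ≤ (1 + m) * (1 + l ^ 2) ^ (α / 2) := by
  have hl : (l ^ 2) ^ (α / 2) = |l| ^ α := by
    rw [← sq_abs, ← Real.rpow_natCast, ← Real.rpow_mul (abs_nonneg l)]
    congr 1
    push_cast
    ring
  have hl0 : 0 ≤ |l| ^ α := by positivity
  have hα2 : 0 ≤ α / 2 := by positivity
  constructor
  · have h1 : (1 + l ^ 2) ^ (α / 2) ≤ 2 ^ (α / 2) * (1 + |l| ^ α) := by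
      rw [← hl]
      rcases le_total (l ^ 2) 1 with h | h
      · calc (1 + l ^ 2) ^ (α / 2) ≤ 2 ^ (α / 2) := by gcongr; linarith
          _ ≤ _ := le_mul_of_one_le_right (by positivity)
            (le_add_of_nonneg_right (by positivity))
      · calc (1 + l ^ 2) ^ (α / 2) ≤ (2 * l ^ 2) ^ (α / 2) := by gcongr; linarith
          _ = 2 ^ (α / 2) * (l ^ 2) ^ (α / 2) := Real.mul_rpow (by norm_num) (by positivity)
          _ ≤ _ := by gcongr; linarith
    refine h1.trans ?_
    rw [mul_assoc]
    gcongr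
    have h2 : (1 + m⁻¹) * (1 + m * |l| ^ α) = 1 + m⁻¹ + m * |l| ^ α + |l| ^ α := by
      field_simp
      ring
    rw [h2]
    have : 0 ≤ m⁻¹ + m * |l| ^ α := by positivity
    linarith
  · have h1 : |l| ^ α ≤ (1 + l ^ 2) ^ (α / 2) := by
      rw [← hl]
      gcongr
      linarith
    have h2 : 1 ≤ (1 + l ^ 2) ^ (α / 2) :=
      Real.one_le_rpow (by nlinarith [sq_nonneg l]) hα2
    nlinarith

lemma mittagLeffler_sq_comparable {β α m : ℝ} (hβ : 0 < β) (hβ1 : β < 1) (hα : 0 ≤ α)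
    (hm : 0 < m) : ∃ K L : ℝ, 0 < K ∧ ∀ l : ℝ,
      mittagLeffler β (-(m * |l| ^ α)) ^ 2 ≤ K * (1 + l ^ 2) ^ (-α) ∧
      (1 + l ^ 2) ^ (-α) ≤ L * mittagLeffler β (-(m * |l| ^ α)) ^ 2 := by
  obtain ⟨A, B, hA, hB, h⟩ := mittagLeffler_neg_bounds hβ hβ1
  set D : ℝ := 2 ^ (α / 2) * (1 + m⁻¹) with hD
  refine ⟨(B * D) ^ 2, (A * (1 + m)) ^ 2, by positivity, fun l => ?_⟩
  obtain ⟨h1, h2⟩ := h (m * |l| ^ α) (by positivity)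
  obtain ⟨h3, h4⟩ := one_add_mul_rpow_comparable hα hm l
  set e := mittagLeffler β (-(m * |l| ^ α))
  set x := m * |l| ^ α with hx
  have hx0 : 0 ≤ x := by positivity
  set p := (1 + l ^ 2) ^ (α / 2) with hp
  have hp0 : 0 < p := by positivity
  have hw : (1 + l ^ 2) ^ (-α) = (p⁻¹) ^ 2 := by
    rw [hp, ← Real.rpow_neg (by positivity), ← Real.rpow_mul_natCast (by positivity)]
    congr 1
    push_cast
    ring
  have he : 0 < e := by
    by_contra! hn
    have : A * (e * (1 + x)) ≤ 0 :=
      mul_nonpos_of_nonneg_of_nonpos hA.le (mul_nonpos_of_nonpos_of_nonneg hn (by linarith))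
    linarith
  rw [hw, ← mul_pow, ← mul_pow]
  constructor
  · gcongr
    rw [← div_eq_mul_inv, le_div_iff₀ hp0]
    calc e * p ≤ e * (D * (1 + x)) := by gcongr
      _ = e * (1 + x) * D := by ring
      _ ≤ B * D := by gcongr
  · gcongr
    rw [inv_le_iff_one_le_mul₀ hp0]
    calc 1 ≤ A * (e * (1 + x)) := h1
      _ ≤ A * (e * ((1 + m) * p)) := by gcongr
      _ = A * (1 + m) * e * p := by ring

/-- Spatial mean-square Hölder continuity of the limit field of Theorem 3.1:
if the negative Sobolev norm of kernel differences is Hölder of order `θ` in the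
second variable, then so is the mean-square increment of the limit field. -/
theorem limit_field_spatial_holder
    (β μ α : ℝ) (hβ : β ∈ Set.Ioo (0 : ℝ) 1) (hμ : 0 < μ) (hα : 0 ≤ α)
    (g : ℝ → ℝ → ℂ) (hg : Measurable (Function.uncurry g))
    (θ C₀ : ℝ) (hθ : θ ∈ Set.Ioc (0 : ℝ) 1) (hC₀ : 0 < C₀)
    (hHolder : ∀ x y : ℝ,
      ∫ l : ℝ, ‖g l x - g l y‖ ^ 2 * (1 + l ^ 2) ^ (-α) ≤ C₀ * |x - y| ^ (2 * θ)) :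
    ∀ t : ℝ, 0 < t → ∃ C : ℝ, 0 < C ∧ ∀ x y : ℝ,
      ∫ l : ℝ, ‖g l x - g l y‖ ^ 2 * (mittagLeffler β (-(μ * t ^ β * |l| ^ α))) ^ 2 ≤
        C * |x - y| ^ (2 * θ) := by
  intro t ht
  obtain ⟨K, L, hK, h⟩ := mittagLeffler_sq_comparable (m := μ * t ^ β) hβ.1 hβ.2 hα
    (by positivity)
  refine ⟨K * C₀, by positivity, fun x y => ?_⟩
  have hnn : 0 ≤ |x - y| ^ (2 * θ) := by positivity
  by_cases hint : Integrable fun l : ℝ => ‖g l x - g l y‖ ^ 2 * (1 + l ^ 2) ^ (-α)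
  · calc ∫ l : ℝ, ‖g l x - g l y‖ ^ 2 * (mittagLeffler β (-(μ * t ^ β * |l| ^ α))) ^ 2
        ≤ ∫ l : ℝ, K * (‖g l x - g l y‖ ^ 2 * (1 + l ^ 2) ^ (-α)) := by
          refine integral_mono_of_nonneg (Filter.Eventually.of_forall fun l => by positivity)
            (hint.const_mul K) (Filter.Eventually.of_forall fun l => ?_)
          simp only
          rw [mul_left_comm]
          exact mul_le_mul_of_nonneg_left (h l).1 (by positivity)
      _ = K * ∫ l : ℝ, ‖g l x - g l y‖ ^ 2 * (1 + l ^ 2) ^ (-α) := integral_const_mul _ _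
      _ ≤ K * (C₀ * |x - y| ^ (2 * θ)) := by gcongr; exact hHolder x y
      _ = K * C₀ * |x - y| ^ (2 * θ) := by ring
  · rw [integral_undef]
    · positivity
    · refine fun hint' => hint ?_
      have hmeas : ∀ z, Measurable fun l => g l z := fun z => hg.comp measurable_prodMk_right
      refine (hint'.const_mul L).mono' ?_ (Filter.Eventually.of_forall fun l => ?_)
      · have h1 := hmeas x
        have h2 := hmeas y
        exact Measurable.aestronglyMeasurable (by fun_prop)
      · rw [Real.norm_of_nonneg (by positivity), mul_left_comm]
        exact mul_le_mul_of_nonneg_left (h l).2 (by positivity)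
end
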